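/- arXiv:2603.27795 — 2 statements merged into one kernel-verified Lean document; each statement's English description precedes it below -/
import Mathlib

section
/- There exists a subset S ⊆ V of vertices such that (1) |S| ≤ c·opt, and (2) the induced subgraph G[V \ S] has at most C·opt/p edges, where the constants can be chosen as c = C = 2(e/(e−1) + 2) < 8. -/
open Finset

noncomputable section
open scoped Classical

variable {V : Type*} [Fintype V] [DecidableEq V]

/-- The probability that the realized graph `G* ~ G_p` (each edge of the base edge set `E`
kept independently with probability `p`) has edge set exactly `F`. -/
def edgeWeight (p : ℝ) (E F : Finset (Sym2 V)) : ℝ :=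
  p ^ F.card * (1 - p) ^ (E \ F).card

/-- The probability of an event `A` of the realized graph `G* ~ G_p`, where `E` is the
edge set of the base graph. -/
def probEvent (p : ℝ) (E : Finset (Sym2 V)) (A : Finset (Sym2 V) → Prop) : ℝ :=
  ∑ F ∈ E.powerset, if A F then edgeWeight p E F else 0

/-- The expectation of a real-valued function of the realized graph `G* ~ G_p`. -/
def expVal (p : ℝ) (E : Finset (Sym2 V)) (X : Finset (Sym2 V) → ℝ) : ℝ :=
  ∑ F ∈ E.powerset, edgeWeight p E F * X F

/-- `C` is a vertex cover of the graph with edge set `F`. -/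
def IsCoverOf (C : Finset V) (F : Finset (Sym2 V)) : Prop :=
  ∀ e ∈ F, ∃ v ∈ C, v ∈ e

/-- `MVC` assigns to every spanning subgraph of the base graph (given by its edge set
`F ⊆ E`) a vertex cover of minimum size. -/
def IsMinCoverFn (E : Finset (Sym2 V)) (MVC : Finset (Sym2 V) → Finset V) : Prop :=
  ∀ F ⊆ E, IsCoverOf (MVC F) F ∧ ∀ C : Finset V, IsCoverOf C F → (MVC F).card ≤ C.card

/-- `opt = E[|MVC(G*)|]`. -/
def optVal (p : ℝ) (E : Finset (Sym2 V)) (MVC : Finset (Sym2 V) → Finset V) : ℝ :=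
  expVal p E fun F => ((MVC F).card : ℝ)

/-- The number of edges of the induced subgraph `G[V \ S]` of the base graph. -/
def inducedEdgeCount (G : SimpleGraph V) [DecidableRel G.Adj] (S : Finset V) : ℕ :=
  (G.edgeFinset.filter fun e => ∀ v ∈ e, v ∉ S).card

lemma expVal_insert (p : ℝ) (E : Finset (Sym2 V)) (e : Sym2 V) (he : e ∉ E)
    (X : Finset (Sym2 V) → ℝ) :
    expVal p (insert e E) X
      = p * expVal p E (fun F => X (insert e F)) + (1 - p) * expVal p E X := by
  unfold expVal
  rw [Finset.sum_powerset_insert he, add_comm, Finset.mul_sum, Finset.mul_sum]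
  congr 1
  · apply Finset.sum_congr rfl
    intro F hF
    have hF' := Finset.mem_powerset.1 hF
    have h1 : e ∉ F := fun h => he (hF' h)
    have h2 : insert e E \ insert e F = E \ F := by
      ext x; simp only [Finset.mem_sdiff, Finset.mem_insert]
      constructor
      · tauto
      · rintro ⟨a, b⟩
        refine ⟨Or.inr a, ?_⟩
        rintro (rfl | h)
        · exact he a
        · exact b h
    unfold edgeWeight
    rw [h2, Finset.card_insert_of_notMem h1]
    ring
  · apply Finset.sum_congr rfl
    intro F hF
    have hF' := Finset.mem_powerset.1 hF
    have h1 : e ∉ F := fun h => he (hF' h)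
    unfold edgeWeight
    rw [Finset.insert_sdiff_of_notMem _ h1,
      Finset.card_insert_of_notMem (fun h => he (Finset.mem_sdiff.1 h).1)]
    ring

lemma expVal_mono (p : ℝ) (hp0 : 0 ≤ p) (hp1 : p ≤ 1) (E : Finset (Sym2 V))
    (X Y : Finset (Sym2 V) → ℝ) (h : ∀ F ⊆ E, X F ≤ Y F) : expVal p E X ≤ expVal p E Y := by
  unfold expVal
  apply Finset.sum_le_sum
  intro F hF
  apply mul_le_mul_of_nonneg_left (h F (Finset.mem_powerset.1 hF))
  unfold edgeWeight
  have : 0 ≤ 1 - p := by linarith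
  positivity

lemma expVal_one_add (p : ℝ) (E : Finset (Sym2 V)) :
    ∀ X : Finset (Sym2 V) → ℝ, expVal p E (fun F => 1 + X F) = 1 + expVal p E X := by
  induction E using Finset.induction_on with
  | empty => intro X; simp [expVal, edgeWeight]
  | insert e E he ih =>
    intro X
    rw [expVal_insert p E e he, expVal_insert p E e he, ih, ih]
    ring

lemma expVal_filter (p : ℝ) (P : Sym2 V → Prop) [DecidablePred P] (E : Finset (Sym2 V)) :
    ∀ X : Finset (Sym2 V) → ℝ,
      expVal p E (fun F => X (F.filter P)) = expVal p (E.filter P) X := by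
  induction E using Finset.induction_on with
  | empty => intro X; simp [expVal, edgeWeight]
  | insert e E he ih =>
    intro X
    rw [expVal_insert p E e he, Finset.filter_insert]
    by_cases hP : P e
    · rw [if_pos hP, expVal_insert p _ e (fun h => he (Finset.mem_filter.1 h).1), ← ih X,
        ← ih (fun F => X (insert e F))]
      simp only [Finset.filter_insert, if_pos hP]
    · rw [if_neg hP]
      simp only [Finset.filter_insert, if_neg hP]
      rw [ih X]
      ring

lemma greedy_aux (p : ℝ) (hp0 : 0 < p) (hp1 : p ≤ 1) (U : Finset (Sym2 V))
    (T : Finset (Sym2 V) → ℝ) (hT0 : ∀ F, 0 ≤ T F)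
    (hT : ∀ u v : V, ∀ F ⊆ U, s(u, v) ∈ U →
      1 + T (F.filter fun e => u ∉ e ∧ v ∉ e) ≤ T (insert s(u, v) F)) (n : ℕ) :
    ∀ E ⊆ U, E.card ≤ n → ∃ S : Finset V,
      (S.card : ℝ) + p * ((E.filter fun e => ∀ v ∈ e, v ∉ S).card : ℝ) ≤ 3 * expVal p E T := by
  induction n with
  | zero =>
    intro E _ hc
    have : E = ∅ := Finset.card_eq_zero.1 (by omega)
    subst this
    refine ⟨∅, ?_⟩
    have := hT0 ∅
    simp [expVal, edgeWeight, this]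
  | succ n ih =>
    intro E hE hc
    rcases Finset.eq_empty_or_nonempty E with h0 | ⟨e, he⟩
    · exact ih E hE (by simp [h0])
    induction e using Sym2.ind with
    | _ u v =>
    set E0 := E.erase s(u, v) with hE0
    have hins : insert s(u, v) E0 = E := Finset.insert_erase he
    have hni : s(u, v) ∉ E0 := Finset.notMem_erase _ _
    have hE0U : E0 ⊆ U := (Finset.erase_subset _ _).trans hE
    have hc0 : E0.card ≤ n := by
      rw [hE0, Finset.card_erase_of_mem he]; omega
    set E1 := E0.filter (fun e => u ∉ e ∧ v ∉ e) with hE1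
    obtain ⟨S0, hS0⟩ := ih E0 hE0U hc0
    obtain ⟨S1, hS1⟩ := ih E1 ((Finset.filter_subset _ _).trans hE0U)
      ((Finset.card_filter_le _ _).trans hc0)
    have hexp : p * (1 + expVal p E1 T) + (1 - p) * expVal p E0 T ≤ expVal p E T := by
      rw [← hins, expVal_insert p E0 _ hni]
      have h1 : 1 + expVal p E1 T ≤ expVal p E0 (fun F => T (insert s(u, v) F)) := by
        rw [hE1, ← expVal_filter, ← expVal_one_add]
        exact expVal_mono p hp0.le hp1 _ _ _ fun F hF => hT u v F (hF.trans hE0U) (hE he)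
      have := mul_le_mul_of_nonneg_left h1 hp0.le
      linarith
    have hA : ((E.filter fun e => ∀ w ∈ e, w ∉ S0).card : ℝ)
        ≤ ((E0.filter fun e => ∀ w ∈ e, w ∉ S0).card : ℝ) + 1 := by
      have : (E.filter fun e => ∀ w ∈ e, w ∉ S0)
          ⊆ insert s(u, v) (E0.filter fun e => ∀ w ∈ e, w ∉ S0) := by
        rw [← hins, Finset.filter_insert]
        split_ifs
        · exact subset_rfl
        · exact Finset.subset_insert _ _
      exact_mod_cast (Finset.card_le_card this).trans (Finset.card_insert_le _ _)
    have hB : ((E.filter fun e => ∀ w ∈ e, w ∉ insert u (insert v S1)).card : ℝ)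
        ≤ ((E1.filter fun e => ∀ w ∈ e, w ∉ S1).card : ℝ) := by
      have : (E.filter fun e => ∀ w ∈ e, w ∉ insert u (insert v S1))
          ⊆ (E1.filter fun e => ∀ w ∈ e, w ∉ S1) := by
        intro x hx
        rw [Finset.mem_filter] at hx
        obtain ⟨hx, hx2⟩ := hx
        have hu : u ∉ x := fun h => hx2 u h (by simp)
        have hv : v ∉ x := fun h => hx2 v h (by simp)
        rw [Finset.mem_filter, hE1, Finset.mem_filter, hE0, Finset.mem_erase]
        refine ⟨⟨⟨?_, hx⟩, hu, hv⟩, fun w hw h => hx2 w hw (by simp [h])⟩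
        rintro rfl
        exact hu (by simp)
      exact_mod_cast Finset.card_le_card this
    have hS : ((insert u (insert v S1)).card : ℝ) ≤ S1.card + 2 := by
      have h1 := Finset.card_insert_le u (insert v S1)
      have h2 := Finset.card_insert_le v S1
      exact_mod_cast (by omega : (insert u (insert v S1)).card ≤ S1.card + 2)
    by_contra hcon
    push Not at hcon
    have k0 := hcon S0
    have k1 := hcon (insert u (insert v S1))
    have hA' := mul_le_mul_of_nonneg_left hA hp0.le
    have hB' := mul_le_mul_of_nonneg_left hB hp0.le
    have j0 : 3 * expVal p E T < 3 * expVal p E0 T + p := by linarith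
    have j1 : 3 * expVal p E T < 3 * expVal p E1 T + 2 := by linarith
    have q0 := mul_le_mul_of_nonneg_left j0.le (by linarith : 0 ≤ 1 - p)
    have q1 := mul_lt_mul_of_pos_left j1 hp0
    nlinarith

/-- Lemma 5.5, structural lemma. There exists a subset `S ⊆ V` such that
(1) `|S| ≤ c·opt` and (2) the induced subgraph `G[V \ S]` has at most `C·opt/p` edges,
where `c = C = 2(e/(e−1) + 2) < 8`. -/
theorem structural_lemma
    (G : SimpleGraph V) [DecidableRel G.Adj]
    (p : ℝ) (hp0 : 0 < p) (hp1 : p ≤ 1)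
    (MVC : Finset (Sym2 V) → Finset V)
    (hMVC : IsMinCoverFn G.edgeFinset MVC)
    (opt : ℝ) (hopt : opt = optVal p G.edgeFinset MVC)
    (c C : ℝ) (hc : c = 2 * (Real.exp 1 / (Real.exp 1 - 1) + 2))
    (hC : C = 2 * (Real.exp 1 / (Real.exp 1 - 1) + 2)) :
    ∃ S : Finset V,
      (S.card : ℝ) ≤ c * opt ∧ (inducedEdgeCount G S : ℝ) ≤ C * opt / p := by
  have key := greedy_aux p hp0 hp1 G.edgeFinset (fun F => ((MVC F).card : ℝ))
    (fun F => Nat.cast_nonneg _) (by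
      intro u v F hF huv
      have hsub : insert s(u, v) F ⊆ G.edgeFinset := Finset.insert_subset huv hF
      obtain ⟨hcov, -⟩ := hMVC _ hsub
      obtain ⟨-, hmin⟩ := hMVC (F.filter fun e => u ∉ e ∧ v ∉ e)
        ((Finset.filter_subset _ _).trans hF)
      have h1 := hmin (MVC (insert s(u, v) F) \ {u, v}) (by
        intro e he
        rw [Finset.mem_filter] at he
        obtain ⟨he, hu, hv⟩ := he
        obtain ⟨w, hw, hwe⟩ := hcov e (Finset.mem_insert_of_mem he)
        refine ⟨w, ?_, hwe⟩
        rw [Finset.mem_sdiff]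
        refine ⟨hw, ?_⟩
        simp only [Finset.mem_insert, Finset.mem_singleton]
        rintro (rfl | rfl)
        · exact hu hwe
        · exact hv hwe)
      have h2 : (MVC (insert s(u, v) F) \ {u, v}).card < (MVC (insert s(u, v) F)).card := by
        apply Finset.card_lt_card
        obtain ⟨w, hw, hwe⟩ := hcov s(u, v) (Finset.mem_insert_self _ _)
        refine Finset.ssubset_iff_subset_ne.2 ⟨Finset.sdiff_subset, fun h => ?_⟩
        rw [← h, Finset.mem_sdiff] at hw
        apply hw.2
        simpa using hwe
      have h3 := lt_of_le_of_lt h1 h2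
      exact_mod_cast (by omega : 1 + (MVC (F.filter fun e => u ∉ e ∧ v ∉ e)).card
        ≤ (MVC (insert s(u, v) F)).card))
    G.edgeFinset.card G.edgeFinset subset_rfl le_rfl
  obtain ⟨S, hS⟩ := key
  change _ ≤ 3 * optVal p G.edgeFinset MVC at hS
  rw [← hopt] at hS
  have hS' : (S.card : ℝ) + p * (inducedEdgeCount G S : ℝ) ≤ 3 * opt := hS
  have hn1 : (0 : ℝ) ≤ S.card := Nat.cast_nonneg _
  have hn2 : (0 : ℝ) ≤ p * (inducedEdgeCount G S : ℝ) :=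
    mul_nonneg hp0.le (Nat.cast_nonneg _)
  have hopt0 : 0 ≤ opt := by linarith
  have he : 0 ≤ Real.exp 1 / (Real.exp 1 - 1) := by
    have := Real.add_one_le_exp (1 : ℝ)
    exact div_nonneg (by linarith) (by linarith)
  have hc3 : 3 * opt ≤ c * opt := mul_le_mul_of_nonneg_right (by linarith) hopt0
  have hC3 : 3 * opt ≤ C * opt := mul_le_mul_of_nonneg_right (by linarith) hopt0
  refine ⟨S, by linarith, ?_⟩
  rw [le_div_iff₀ hp0]
  linarith
end
end

section
/- Let δ, γ ∈ (0,1) and suppose v_1, …, v_k are vertices of G such that for every i ∈ {1, …, k}, Pr_{G*~G_p}[v_i ∈ PROBLEMATIC((v_1,…,v_{i−1}), G*)] ≥ δ. If n ≥ 4·log(2/δ), then k ≤ (10γ/δ)·n. -/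
open Finset

noncomputable section
open scoped Classical

variable {V : Type*} [Fintype V] [DecidableEq V]

/-- `DECIDED(Q, G*)`: vertices outside `Q` having a neighbor in the realized graph
(with edge set `F`) belonging to `Q \ VC(G*)`. -/
def decidedSet (VC : Finset (Sym2 V) → Finset V) (Q : Finset V)
    (F : Finset (Sym2 V)) : Finset V :=
  (Finset.univ \ Q).filter fun v => ∃ u ∈ Q \ VC F, s(u, v) ∈ F

/-- `UNDECIDED(Q, G*) = (V \ Q) \ DECIDED(Q, G*)`. -/
def undecidedSet (VC : Finset (Sym2 V) → Finset V) (Q : Finset V)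
    (F : Finset (Sym2 V)) : Finset V :=
  (Finset.univ \ Q) \ decidedSet VC Q F

/-- `PROBLEMATIC(Q, G*)`: vertices `v ∉ Q` with `v ∉ VC(G*)` having at least `1/(p·γ)`
neighbors in the base graph `G` belonging to `UNDECIDED(Q, G*)`. -/
def problematicSet (G : SimpleGraph V) [DecidableRel G.Adj] (p γ : ℝ)
    (VC : Finset (Sym2 V) → Finset V) (Q : Finset V) (F : Finset (Sym2 V)) : Finset V :=
  (Finset.univ \ Q).filter fun v => v ∉ VC F ∧
    1 / (p * γ) ≤ ((G.neighborFinset v ∩ undecidedSet VC Q F).card : ℝ)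

lemma edgeWeight_nonneg' (p : ℝ) (hp0 : 0 < p) (hp1 : p ≤ 1) (E F : Finset (Sym2 V)) :
    0 ≤ edgeWeight p E F := by
  unfold edgeWeight
  have : 0 ≤ 1 - p := by linarith
  positivity

def stepFac (p : ℝ) (τ : Sym2 V → Finset (Sym2 V) → Prop) (F : Finset (Sym2 V))
    (e : Sym2 V) : ℝ :=
  if τ e F then (if e ∈ F then 1 / 2 else 1) / (1 - p / 2) else 1

lemma tree_sum (p : ℝ) (hp1 : p ≤ 1) (r : Sym2 V → ℕ)
    (τ : Sym2 V → Finset (Sym2 V) → Prop)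
    (hτ : ∀ e F F', (∀ e', r e' < r e → (e' ∈ F ↔ e' ∈ F')) → (τ e F ↔ τ e F'))
    (E : Finset (Sym2 V)) :
    ∑ F ∈ E.powerset, edgeWeight p E F * ∏ e ∈ E, stepFac p τ F e = 1 := by
  induction E using Finset.induction_on_max_value r with
  | empty => simp [edgeWeight]
  | insert e E he hmax ih =>
    rw [Finset.sum_powerset_insert he, ← Finset.sum_add_distrib, ← ih]
    apply Finset.sum_congr rfl
    intro F hF
    rw [Finset.mem_powerset] at hF
    have heF : e ∉ F := fun h => he (hF h)
    rw [Finset.prod_insert he, Finset.prod_insert he]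
    have hw1 : edgeWeight p (insert e E) F = edgeWeight p E F * (1 - p) := by
      unfold edgeWeight
      rw [Finset.insert_sdiff_of_notMem _ heF, Finset.card_insert_of_notMem (by simp [he])]
      ring
    have hw2 : edgeWeight p (insert e E) (insert e F) = edgeWeight p E F * p := by
      unfold edgeWeight
      have : insert e E \ insert e F = E \ F := by
        ext x; simp only [Finset.mem_sdiff, Finset.mem_insert]
        constructor
        · tauto
        · rintro ⟨h1, h2⟩
          refine ⟨Or.inr h1, ?_⟩
          rintro (rfl | h)
          · exact he h1
          · exact h2 h
      rw [this, Finset.card_insert_of_notMem heF]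
      ring
    have hag : ∀ x, r x ≤ r e → (τ x (insert e F) ↔ τ x F) := by
      intro x hx
      apply hτ
      intro e' he'
      have : e' ≠ e := by rintro rfl; omega
      simp [this]
    have hprod : ∏ x ∈ E, stepFac p τ (insert e F) x = ∏ x ∈ E, stepFac p τ F x := by
      apply Finset.prod_congr rfl
      intro x hx
      have hne : x ≠ e := by rintro rfl; exact he hx
      simp only [stepFac, hag x (hmax x hx), Finset.mem_insert, hne, false_or]
    rw [hw1, hw2, hprod]
    have hfac : (1 - p) * stepFac p τ F e + p * stepFac p τ (insert e F) e = 1 := by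
      simp only [stepFac, hag e le_rfl, heF, Finset.mem_insert_self, if_true, if_false]
      split_ifs
      · have : (1 - p / 2) ≠ 0 := by linarith
        rw [mul_div_assoc', mul_div_assoc', ← add_div, div_eq_one_iff_eq this]
        ring
      · ring
    linear_combination (edgeWeight p E F * ∏ x ∈ E, stepFac p τ F x) * hfac

lemma prod_lower (p : ℝ) (hp1 : p ≤ 1) (τ : Sym2 V → Finset (Sym2 V) → Prop)
    (E F : Finset (Sym2 V)) (n : ℕ)
    (hs : (E.filter fun e => τ e F ∧ e ∈ F).card ≤ n) :
    (1 / 2 : ℝ) ^ n * Real.exp (p / 2 * (E.filter fun e => τ e F).card) ≤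
      ∏ e ∈ E, stepFac p τ F e := by
  have hc : 0 < 1 - p / 2 := by linarith
  have h1 : ∏ e ∈ E, stepFac p τ F e =
      (1 / 2 : ℝ) ^ (E.filter fun e => τ e F ∧ e ∈ F).card *
        (1 / (1 - p / 2)) ^ (E.filter fun e => τ e F).card := by
    rw [← Finset.prod_const, ← Finset.prod_const, Finset.prod_filter, Finset.prod_filter,
      ← Finset.prod_mul_distrib]
    apply Finset.prod_congr rfl
    intro e _
    unfold stepFac
    by_cases h : τ e F <;> by_cases h' : e ∈ F <;> simp [h, h'] <;> ring
  rw [h1]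
  have h2 : Real.exp (p / 2) ≤ 1 / (1 - p / 2) := by
    rw [le_div_iff₀ hc]
    have := Real.add_one_le_exp (-(p / 2))
    calc Real.exp (p / 2) * (1 - p / 2) ≤ Real.exp (p / 2) * Real.exp (-(p / 2)) := by
          gcongr; linarith
      _ = 1 := by rw [← Real.exp_add]; simp
  have h3 : Real.exp (p / 2 * (E.filter fun e => τ e F).card) =
      Real.exp (p / 2) ^ (E.filter fun e => τ e F).card := by
    rw [mul_comm, Real.exp_nat_mul]
  rw [h3]
  apply mul_le_mul
  · exact pow_le_pow_of_le_one (by norm_num) (by norm_num) hs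
  · gcongr
  · positivity
  · positivity

def prefSet {k : ℕ} (v : Fin k → V) (i : Fin k) : Finset V :=
  ((Finset.univ : Finset (Fin k)).filter fun j => j < i).image v

def tested {k : ℕ} (v : Fin k → V) (I : Finset V) (e : Sym2 V) (F : Finset (Sym2 V)) : Prop :=
  ∃ i u, v i ∈ I ∧ u ∉ prefSet v i ∧ (∀ w ∈ prefSet v i, w ∈ I → s(w, u) ∉ F) ∧ e = s(v i, u)

def rnk {k : ℕ} (v : Fin k → V) (e : Sym2 V) : ℕ :=
  sInf {m : ℕ | ∃ i : Fin k, (i : ℕ) = m ∧ v i ∈ e}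

lemma rnk_le {k : ℕ} (v : Fin k → V) (i : Fin k) (e : Sym2 V) (h : v i ∈ e) :
    rnk v e ≤ i := Nat.sInf_le ⟨i, rfl, h⟩

lemma rnk_eq {k : ℕ} (v : Fin k → V) (hv : Function.Injective v) (i : Fin k) (u : V)
    (hu : u ∉ prefSet v i) : rnk v s(v i, u) = i := by
  apply le_antisymm (rnk_le v i _ (by simp))
  unfold rnk
  refine le_csInf (s := {m : ℕ | ∃ j : Fin k, (j : ℕ) = m ∧ v j ∈ s(v i, u)}) ⟨i, i, rfl, by simp⟩ ?_
  rintro m ⟨j, rfl, hj⟩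
  rw [Sym2.mem_iff] at hj
  rcases hj with h | h
  · rw [hv h]
  · by_contra hlt
    exact hu (by unfold prefSet; simp only [Finset.mem_image, Finset.mem_filter]; exact ⟨j, ⟨Finset.mem_univ _, by simpa using hlt⟩, h⟩)

lemma tested_pred {k : ℕ} (v : Fin k → V) (hv : Function.Injective v) (I : Finset V)
    (e : Sym2 V) (F F' : Finset (Sym2 V))
    (h : ∀ e', rnk v e' < rnk v e → (e' ∈ F ↔ e' ∈ F')) :
    tested v I e F → tested v I e F' := by
  rintro ⟨i, u, hi, hu, hw, rfl⟩
  refine ⟨i, u, hi, hu, ?_, rfl⟩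
  intro w hwQ hwI
  rw [← h]
  · exact hw w hwQ hwI
  · rw [rnk_eq v hv i u hu]
    unfold prefSet at hwQ
    simp only [Finset.mem_image, Finset.mem_filter] at hwQ
    obtain ⟨j, ⟨-, hj⟩, rfl⟩ := hwQ
    exact lt_of_le_of_lt (rnk_le v j _ (by simp)) hj

lemma succ_le {k : ℕ} (v : Fin k → V) (I : Finset V) (E F : Finset (Sym2 V)) :
    (E.filter fun e => tested v I e F ∧ e ∈ F).card ≤ Fintype.card V := by
  have : ∀ e ∈ (E.filter fun e => tested v I e F ∧ e ∈ F), ∃ u : V, ∃ i, v i ∈ I ∧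
      (∀ w ∈ prefSet v i, w ∈ I → s(w, u) ∉ F) ∧ e = s(v i, u) ∧ e ∈ F := by
    intro e he
    obtain ⟨-, ⟨i, u, hi, hu, hw, rfl⟩, h⟩ := Finset.mem_filter.1 he
    exact ⟨u, i, hi, hw, rfl, h⟩
  rcases isEmpty_or_nonempty V with hV | hV
  · have : (E.filter fun e => tested v I e F ∧ e ∈ F) = ∅ := by
      apply Finset.eq_empty_of_forall_notMem
      intro e he
      obtain ⟨u, -⟩ := this e he
      exact hV.elim u
    rw [this]; simp
  choose! f hf using this
  rw [← Finset.card_univ]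
  apply Finset.card_le_card_of_injOn f (fun _ _ => Finset.mem_coe.2 (Finset.mem_univ _))
  intro e he e' he' hee
  obtain ⟨i, hi, hw, h1, h2⟩ := hf e he
  obtain ⟨j, hj, hw', h1', h2'⟩ := hf e' he'
  rw [← hee] at hw' h1'
  have mem : ∀ a b : Fin k, a < b → v a ∈ prefSet v b := by
    intro a b hab
    unfold prefSet
    exact Finset.mem_image_of_mem _ (by simp [hab])
  rcases lt_trichotomy i j with h | h | h
  · exact absurd (h1 ▸ h2) (hw' _ (mem _ _ h) hi)
  · rw [h1, h1', h]
  · exact absurd (h1' ▸ h2') (hw _ (mem _ _ h) hj)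

lemma tests_ge {k : ℕ} (G : SimpleGraph V) [DecidableRel G.Adj] (p γ : ℝ)
    (VC : Finset (Sym2 V) → Finset V)
    (v : Fin k → V) (hv : Function.Injective v) (F : Finset (Sym2 V)) :
    ((Finset.univ.filter fun i => v i ∈ problematicSet G p γ VC (prefSet v i) F).card : ℝ)
      * (1 / (p * γ)) ≤
      ((G.edgeFinset.filter fun e => tested v (Finset.univ \ VC F) e F).card : ℝ) := by
  set S := Finset.univ.filter fun i => v i ∈ problematicSet G p γ VC (prefSet v i) F with hS
  have h1 : (S.card : ℝ) * (1 / (p * γ)) ≤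
      ∑ i ∈ S, ((G.neighborFinset (v i) ∩ undecidedSet VC (prefSet v i) F).card : ℝ) := by
    rw [← nsmul_eq_mul]
    apply Finset.card_nsmul_le_sum
    intro i hi
    simp only [hS, problematicSet, Finset.mem_filter] at hi
    exact hi.2.2.2
  refine h1.trans ?_
  rw [← Nat.cast_sum, ← Finset.card_sigma]
  norm_cast
  have key : ∀ x ∈ S.sigma fun i => G.neighborFinset (v i) ∩ undecidedSet VC (prefSet v i) F,
      v x.1 ∉ VC F ∧ G.Adj (v x.1) x.2 ∧ x.2 ∉ prefSet v x.1 ∧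
        (∀ w ∈ prefSet v x.1, w ∉ VC F → s(w, x.2) ∉ F) := by
    rintro ⟨i, u⟩ hx
    simp only [Finset.mem_sigma, hS, problematicSet, undecidedSet, decidedSet, Finset.mem_filter,
      Finset.mem_inter, Finset.mem_sdiff, Finset.mem_univ, true_and,
      SimpleGraph.mem_neighborFinset] at hx
    obtain ⟨⟨-, h1, -⟩, h2, h3, h4⟩ := hx
    refine ⟨h1, h2, h3, fun w hw hw' hF => h4 ⟨h3, w, ⟨hw, hw'⟩, hF⟩⟩
  apply Finset.card_le_card_of_injOn (fun x => s(v x.1, x.2))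
  · intro x hx
    obtain ⟨h1, h2, h3, h4⟩ := key x hx
    simp only [Finset.coe_filter, Set.mem_ofPred_eq, SimpleGraph.mem_edgeFinset,
      SimpleGraph.mem_edgeSet]
    exact ⟨h2, x.1, x.2, by simp [h1], h3, fun w hw hw' => h4 w hw (by simpa using hw'), rfl⟩
  · rintro ⟨i, u⟩ hx ⟨j, w⟩ hy hxy
    obtain ⟨-, -, h3, -⟩ := key _ hx
    obtain ⟨-, -, h3', -⟩ := key _ hy
    dsimp only at hxy h3 h3'
    have hij : i = j := by
      apply Fin.ext
      rw [← rnk_eq v hv i u h3, ← rnk_eq v hv j w h3', hxy]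
    subst hij
    rw [Sym2.congr_right] at hxy
    rw [hxy]

lemma sum_weight (p : ℝ) (hp1 : p ≤ 1) (E : Finset (Sym2 V)) :
    ∑ F ∈ E.powerset, edgeWeight p E F = 1 := by
  have := tree_sum p hp1 (fun _ => 0) (fun _ _ => False) (by simp) E
  simpa [stepFac] using this

/-- Lemma 4.1. Let `δ, γ ∈ (0,1)` and suppose `v_1, …, v_k` are vertices
of `G` such that for every `i`, `Pr_{G*~G_p}[v_i ∈ PROBLEMATIC((v_1,…,v_{i−1}), G*)] ≥ δ`.
If `n ≥ 4·log(2/δ)`, then `k ≤ (10γ/δ)·n`. -/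
theorem vertex_seed_bound
    (G : SimpleGraph V) [DecidableRel G.Adj]
    (p : ℝ) (hp0 : 0 < p) (hp1 : p ≤ 1)
    (VC : Finset (Sym2 V) → Finset V)
    (hVC : ∀ F ⊆ G.edgeFinset, IsCoverOf (VC F) F)
    (δ γ : ℝ) (hδ0 : 0 < δ) (hδ1 : δ < 1) (hγ0 : 0 < γ) (hγ1 : γ < 1)
    (k : ℕ) (v : Fin k → V)
    (hprob : ∀ i : Fin k,
      δ ≤ probEvent p G.edgeFinset (fun F =>
        v i ∈ problematicSet G p γ VC
          (((Finset.univ : Finset (Fin k)).filter fun j => j < i).image v) F))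
    (hn : 4 * Real.log (2 / δ) ≤ (Fintype.card V : ℝ)) :
    (k : ℝ) ≤ 10 * γ / δ * Fintype.card V := by
  set n := Fintype.card V with hnn
  have hv : Function.Injective v := by
    have key : ∀ j i : Fin k, j < i → v j ≠ v i := by
      intro j i hji heq
      have h := hprob i
      have h0 : probEvent p G.edgeFinset (fun F =>
        v i ∈ problematicSet G p γ VC
          (((Finset.univ : Finset (Fin k)).filter fun j => j < i).image v) F) = 0 := by
        unfold probEvent
        apply Finset.sum_eq_zero
        intro F _
        rw [if_neg]
        intro hm
        simp only [problematicSet, Finset.mem_filter, Finset.mem_sdiff] at hm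
        exact hm.1.2 (heq ▸ Finset.mem_image_of_mem _ (by simp [hji]))
      linarith
    intro a b hab
    rcases lt_trichotomy a b with h | h | h
    · exact absurd hab (key _ _ h)
    · exact h
    · exact absurd hab.symm (key _ _ h)
  set E := G.edgeFinset with hE
  let N : Finset (Sym2 V) → ℝ := fun F =>
    ((Finset.univ.filter fun i => v i ∈ problematicSet G p γ VC (prefSet v i) F).card : ℝ)
  have hES : δ * k ≤ ∑ F ∈ E.powerset, edgeWeight p E F * N F := by
    have h1 : ∑ i : Fin k, δ ≤ ∑ i : Fin k, ∑ F ∈ E.powerset,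
        (if v i ∈ problematicSet G p γ VC (prefSet v i) F then edgeWeight p E F else 0) :=
      by
      refine Finset.sum_le_sum fun i _ => ?_
      have h := hprob i
      unfold probEvent at h
      refine h.trans (le_of_eq (Finset.sum_congr rfl fun F _ => ?_))
      have hQ : prefSet v i = (((Finset.univ : Finset (Fin k)).filter fun j => j < i).image v) := by
        ext x; simp [prefSet]
      rw [hQ]
      congr
    rw [Finset.sum_comm] at h1
    simp only [Finset.sum_const, Finset.card_univ, Fintype.card_fin, nsmul_eq_mul] at h1
    rw [mul_comm]
    refine h1.trans (le_of_eq ?_)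
    apply Finset.sum_congr rfl
    intro F _
    rw [← Finset.sum_filter, Finset.sum_const, nsmul_eq_mul, mul_comm]
  have hw := edgeWeight_nonneg' (V := V) p hp0 hp1 E
  have hc : 0 < 1 - p / 2 := by linarith
  have hfac : ∀ τ F, 0 ≤ ∏ e ∈ E, stepFac (V := V) p τ F e := by
    intro τ F
    apply Finset.prod_nonneg
    intro e _
    unfold stepFac
    split_ifs <;> positivity
  have hexp : ∑ F ∈ E.powerset, edgeWeight p E F * Real.exp (N F / (2 * γ)) ≤ 4 ^ n := by
    have h1 : ∑ I : Finset V, ∑ F ∈ E.powerset,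
        edgeWeight p E F * ∏ e ∈ E, stepFac p (tested v I) F e = 2 ^ n := by
      rw [Finset.sum_congr rfl fun I _ => tree_sum p hp1 (rnk v) (tested v I)
        (fun e F F' h => ⟨tested_pred v hv I e F F' h,
          tested_pred v hv I e F' F fun e' he' => (h e' he').symm⟩) E]
      simp [hnn]
    rw [Finset.sum_comm] at h1
    have h2 : ∑ F ∈ E.powerset, edgeWeight p E F * ((1 / 2) ^ n * Real.exp (N F / (2 * γ)))
        ≤ 2 ^ n := by
      rw [← h1]
      apply Finset.sum_le_sum
      intro F _
      refine le_trans ?_ (Finset.single_le_sum (f := fun I => edgeWeight p E F *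
        ∏ e ∈ E, stepFac p (tested v I) F e) (fun I _ => mul_nonneg (hw F) (hfac _ _))
        (Finset.mem_univ (Finset.univ \ VC F)))
      apply mul_le_mul_of_nonneg_left _ (hw F)
      refine le_trans ?_ (prod_lower p hp1 _ E F n (succ_le v _ E F))
      gcongr
      have h3 := tests_ge G p γ VC v hv F
      calc N F / (2 * γ) = p / 2 * (N F * (1 / (p * γ))) := by field_simp
        _ ≤ _ := by gcongr
    have h4 : ∑ F ∈ E.powerset, edgeWeight p E F * ((1 / 2) ^ n * Real.exp (N F / (2 * γ)))
        = (1 / 2) ^ n * ∑ F ∈ E.powerset, edgeWeight p E F * Real.exp (N F / (2 * γ)) := by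
      rw [Finset.mul_sum]
      exact Finset.sum_congr rfl fun F _ => by ring
    rw [h4, one_div, inv_pow, inv_mul_le_iff₀ (by positivity), ← mul_pow] at h2
    norm_num at h2
    exact h2
  have hsum := sum_weight p hp1 E
  set a : ℝ := n * Real.log 4 with ha
  have hea : Real.exp a = 4 ^ n := by
    rw [ha, Real.exp_nat_mul, Real.exp_log (by norm_num)]
  have h5 : ∑ F ∈ E.powerset, edgeWeight p E F * (4 ^ n * (N F / (2 * γ) - a + 1)) ≤ 4 ^ n := by
    refine le_trans (Finset.sum_le_sum fun F _ => ?_) hexp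
    apply mul_le_mul_of_nonneg_left _ (hw F)
    have := Real.add_one_le_exp (N F / (2 * γ) - a)
    calc (4 : ℝ) ^ n * (N F / (2 * γ) - a + 1)
        ≤ 4 ^ n * Real.exp (N F / (2 * γ) - a) := by gcongr
      _ = _ := by rw [← hea, ← Real.exp_add]; congr 1; ring
  have h6 : ∑ F ∈ E.powerset, edgeWeight p E F * (4 ^ n * (N F / (2 * γ) - a + 1)) =
      4 ^ n * ((∑ F ∈ E.powerset, edgeWeight p E F * N F) / (2 * γ) + (1 - a)) := by
    have : (1 - a) = ∑ F ∈ E.powerset, edgeWeight p E F * (1 - a) := by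
      rw [← Finset.sum_mul, hsum, one_mul]
    rw [this, Finset.sum_div, ← Finset.sum_add_distrib, Finset.mul_sum]
    exact Finset.sum_congr rfl fun F _ => by ring
  rw [h6] at h5
  have h7 := le_of_mul_le_mul_left (h5.trans_eq (mul_one _).symm) (by positivity : (0:ℝ) < 4 ^ n)
  have h8 : (∑ F ∈ E.powerset, edgeWeight p E F * N F) / (2 * γ) ≤ a := by linarith
  rw [div_le_iff₀ (by positivity)] at h8
  have hlog : Real.log 4 ≤ 3 := by
    have := Real.log_le_sub_one_of_pos (show (0:ℝ) < 4 by norm_num)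
    linarith
  have h9 : a * (2 * γ) ≤ 10 * γ * n := by
    have hn0 : (0:ℝ) ≤ n * γ := by positivity
    rw [ha]
    nlinarith
  rw [div_mul_eq_mul_div, le_div_iff₀ hδ0]
  linarith
end
end
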